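/- Let G = (V, E) be a finite simple claw-free graph containing a simplicial clique K_s, with an operator realization and a simplicial mode χ with respect to K_s. Set H = Σ_{v ∈ V} h(v). Let u₀ ∈ ℂ be nonzero and let Π ∈ M_d(ℂ) satisfy Π·Q_k(G) = Q_k(G)·Π for every k ≥ 0 and Π·T_G(u₀)·T_G(−u₀) = 0. Then the matrix ψ = Π·T_G(−u₀)·χ·T_G(u₀) satisfies the eigenmode relation H·ψ − ψ·H = (2/u₀)·ψ. (Lemma 17.) -/

import Mathlib

open scoped Classical

universe u

/-- `G` is claw-free: no vertex has three pairwise distinct, pairwise non-adjacent neighbors. -/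
def ClawFree {V : Type u} (G : SimpleGraph V) : Prop :=
  ¬ ∃ c x y z : V, x ≠ y ∧ x ≠ z ∧ y ≠ z ∧
    G.Adj c x ∧ G.Adj c y ∧ G.Adj c z ∧ ¬ G.Adj x y ∧ ¬ G.Adj x z ∧ ¬ G.Adj y z

/-- `S` is an independent set of `G`. -/
def IsIndep {V : Type u} (G : SimpleGraph V) (S : Finset V) : Prop :=
  ∀ u ∈ S, ∀ v ∈ S, ¬ G.Adj u v

/-- The product `h(S) = ∏_{v ∈ S} h v`, well defined when the factors pairwise commute. -/
noncomputable def hProd {V : Type u} {d : ℕ} (h : V → Matrix (Fin d) (Fin d) ℂ)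
    (S : Finset V) : Matrix (Fin d) (Fin d) ℂ :=
  if hc : (S : Set V).Pairwise fun u v => Commute (h u) (h v) then S.noncommProd h hc
  else 0

/-- The independent-set charge `Q_k(G)`: the sum of `h(S)` over all independent sets `S` of
`G` with `|S| = k`. -/
noncomputable def charge {V : Type u} {d : ℕ} [Fintype V] [DecidableEq V]
    (G : SimpleGraph V) (h : V → Matrix (Fin d) (Fin d) ℂ) (k : ℕ) :
    Matrix (Fin d) (Fin d) ℂ :=
  ∑ S ∈ Finset.univ.filter (fun S : Finset V => IsIndep G S ∧ S.card = k), hProd h S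

/-- The transfer operator `T_G(u) = Σ_S (−u)^{|S|}·h(S)`, summed over all independent sets
`S` of `G`. -/
noncomputable def transferOp {V : Type u} {d : ℕ} [Fintype V] [DecidableEq V]
    (G : SimpleGraph V) (h : V → Matrix (Fin d) (Fin d) ℂ) (u : ℂ) :
    Matrix (Fin d) (Fin d) ℂ :=
  ∑ S ∈ Finset.univ.filter (fun S : Finset V => IsIndep G S),
    (-u) ^ S.card • hProd h S

/-- `K` is a simplicial clique of `G`: a clique such that, for every `j ∈ K`, the set of
neighbors of `j` outside `K` is a clique. -/
def IsSimplicialClique {V : Type u} (G : SimpleGraph V) (K : Finset V) : Prop :=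
  (∀ u ∈ K, ∀ v ∈ K, u ≠ v → G.Adj u v) ∧
    ∀ j ∈ K, ∀ u v : V, u ∉ K → v ∉ K → u ≠ v → G.Adj j u → G.Adj j v → G.Adj u v

section Aux

variable {V : Type u} {d : ℕ} {G : SimpleGraph V} {h : V → Matrix (Fin d) (Fin d) ℂ}

/-- The relations of an operator realization: each `h v` squares to the scalar `c v`, and
`h u`, `h v` anticommute or commute according to adjacency. -/
structure IsRealization (G : SimpleGraph V) (h : V → Matrix (Fin d) (Fin d) ℂ) (c : V → ℂ) :
    Prop where
  sq : ∀ v, h v * h v = c v • (1 : Matrix (Fin d) (Fin d) ℂ)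
  anti : ∀ u v, G.Adj u v → h u * h v = -(h v * h u)
  comm : ∀ u v, u ≠ v → ¬ G.Adj u v → h u * h v = h v * h u

lemma IsIndep.mono {S T : Finset V} (hS : IsIndep G S) (hTS : T ⊆ S) : IsIndep G T :=
  fun u hu v hv => hS u (hTS hu) v (hTS hv)

lemma hProd_empty : hProd h ∅ = 1 := by
  simp [hProd]

lemma hProd_singleton (v : V) : hProd h {v} = h v := by
  simp [hProd]

lemma commute_hProd {x : Matrix (Fin d) (Fin d) ℂ} {S : Finset V}
    (hx : ∀ v ∈ S, Commute x (h v)) : Commute x (hProd h S) := by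
  unfold hProd
  split_ifs with hc
  · exact Finset.noncommProd_commute S h hc x hx
  · exact Commute.zero_right x

lemma hProd_commute_hProd {A B : Finset V}
    (hAB : ∀ a ∈ A, ∀ b ∈ B, Commute (h a) (h b)) : Commute (hProd h A) (hProd h B) :=
  commute_hProd fun b hb => (commute_hProd fun a ha => (hAB a ha b hb).symm).symm

variable {c : V → ℂ}

lemma IsRealization.pairwise (R : IsRealization G h c) {S : Finset V} (hS : IsIndep G S) :
    (S : Set V).Pairwise fun u v => Commute (h u) (h v) :=
  fun u hu v hv huv => R.comm u v huv (hS u hu v hv)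

lemma ClawFree.card_neighbors_le_two (hcf : ClawFree G) {A : Finset V} (hA : IsIndep G A)
    (b : V) : (A.filter (G.Adj b)).card ≤ 2 := by
  by_contra hlt
  obtain ⟨x, y, z, hx, hy, hz, hxy, hxz, hyz⟩ := Finset.two_lt_card_iff.1 (not_le.1 hlt)
  simp only [Finset.mem_filter] at hx hy hz
  exact hcf ⟨b, x, y, z, hxy, hxz, hyz, hx.2, hy.2, hz.2, hA x hx.1 y hy.1, hA x hx.1 z hz.1,
    hA y hy.1 z hz.1⟩

variable [DecidableEq V]

lemma IsRealization.hProd_union (R : IsRealization G h c) {A B : Finset V}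
    (hAB : IsIndep G (A ∪ B)) (hd : Disjoint A B) :
    hProd h (A ∪ B) = hProd h A * hProd h B := by
  have hA := hAB.mono Finset.subset_union_left
  have hB := hAB.mono Finset.subset_union_right
  rw [hProd, hProd, hProd, dif_pos (R.pairwise hAB), dif_pos (R.pairwise hA),
    dif_pos (R.pairwise hB)]
  convert Finset.noncommProd_union_of_disjoint hd h _ using 2

lemma IsRealization.hProd_insert (R : IsRealization G h c) {S : Finset V} {a : V}
    (hS : IsIndep G (insert a S)) (ha : a ∉ S) :
    hProd h (insert a S) = h a * hProd h S := by
  rw [Finset.insert_eq] at hS ⊢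
  rw [R.hProd_union hS (Finset.disjoint_singleton_left.2 ha), hProd_singleton]

/-- Moving an element past `hProd h S` produces one sign for each factor it anticommutes with. -/
lemma IsRealization.mul_hProd (R : IsRealization G h c) {x : Matrix (Fin d) (Fin d) ℂ}
    {p : V → Prop} {S : Finset V} (hS : IsIndep G S)
    (hp : ∀ v ∈ S, p v → x * h v = -(h v * x)) (hn : ∀ v ∈ S, ¬ p v → x * h v = h v * x) :
    x * hProd h S = (-1 : ℂ) ^ (S.filter p).card • (hProd h S * x) := by
  induction S using Finset.induction_on with
  | empty => simp [hProd_empty]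
  | insert a S ha ih =>
    have ih' := ih (hS.mono (Finset.subset_insert a S))
      (fun v hv => hp v (Finset.mem_insert_of_mem hv))
      (fun v hv => hn v (Finset.mem_insert_of_mem hv))
    rw [R.hProd_insert hS ha, ← mul_assoc, Finset.filter_insert]
    split_ifs with hpa
    · rw [hp a (Finset.mem_insert_self a S) hpa, Finset.card_insert_of_notMem (by simp [ha]),
        neg_mul, mul_assoc, ih', pow_succ]
      simp [mul_assoc]
    · rw [hn a (Finset.mem_insert_self a S) hpa, mul_assoc, ih']
      simp [mul_assoc]

/-- The square of `hProd h I` is a scalar. -/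
lemma IsRealization.hProd_mul_self (R : IsRealization G h c) {I : Finset V}
    (hI : IsIndep G I) : hProd h I * hProd h I = (∏ v ∈ I, c v) • 1 := by
  induction I using Finset.induction_on with
  | empty => simp [hProd_empty]
  | insert a S ha ih =>
    have hc : Commute (h a) (hProd h S) := commute_hProd fun v hv =>
      R.comm a v (by rintro rfl; exact ha hv)
        (hI a (Finset.mem_insert_self a S) v (Finset.mem_insert_of_mem hv))
    rw [R.hProd_insert hI ha, mul_assoc, ← mul_assoc (hProd h S), ← hc.eq, mul_assoc (h a),
      ih (hI.mono (Finset.subset_insert a S)), ← mul_assoc, R.sq, Finset.prod_insert ha]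
    simp [smul_smul, mul_comm]

/-- The sum of `x ^ |A| * y ^ |D \ A| • h(A) * h(D \ A)` over all splittings of `D` into two
independent sets `A` and `D \ A`. -/
noncomputable def splitSum (G : SimpleGraph V) (h : V → Matrix (Fin d) (Fin d) ℂ) (x y : ℂ)
    (D : Finset V) : Matrix (Fin d) (Fin d) ℂ :=
  ∑ A ∈ D.powerset.filter (fun A => IsIndep G A ∧ IsIndep G (D \ A)),
    (x ^ A.card * y ^ (D \ A).card) • (hProd h A * hProd h (D \ A))

lemma IsIndep.union {A B : Finset V} (hA : IsIndep G A) (hB : IsIndep G B)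
    (hAB : ∀ a ∈ A, ∀ b ∈ B, ¬ G.Adj a b) : IsIndep G (A ∪ B) := by
  intro u hu v hv
  rcases Finset.mem_union.1 hu with hu | hu <;> rcases Finset.mem_union.1 hv with hv | hv
  · exact hA u hu v hv
  · exact hAB u hu v hv
  · exact fun e => hAB v hv u hu e.symm
  · exact hB u hu v hv

lemma splitSum_union (R : IsRealization G h c) (x y : ℂ) {D₁ D₂ : Finset V}
    (hd : Disjoint D₁ D₂) (hadj : ∀ a ∈ D₁, ∀ b ∈ D₂, ¬ G.Adj a b) :
    splitSum G h x y (D₁ ∪ D₂) = splitSum G h x y D₁ * splitSum G h x y D₂ := by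
  unfold splitSum
  rw [Finset.sum_mul_sum, ← Finset.sum_product']
  symm
  have key : ∀ A₁ ⊆ D₁, ∀ A₂ ⊆ D₂, (D₁ ∪ D₂) \ (A₁ ∪ A₂) = (D₁ \ A₁) ∪ (D₂ \ A₂) := by
    intro A₁ h1 A₂ h2
    have h3 := Finset.disjoint_left.1 hd
    grind
  have hun : ∀ A₁ ⊆ D₁, ∀ A₂ ⊆ D₂, IsIndep G A₁ → IsIndep G A₂ → IsIndep G (A₁ ∪ A₂) :=
    fun A₁ h1 A₂ h2 i1 i2 => i1.union i2 fun a ha b hb => hadj a (h1 ha) b (h2 hb)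
  refine Finset.sum_nbij' (fun p => p.1 ∪ p.2) (fun A => (A ∩ D₁, A ∩ D₂)) ?_ ?_ ?_ ?_ ?_
  · rintro ⟨A₁, A₂⟩ hA
    simp only [Finset.mem_product, Finset.mem_filter, Finset.mem_powerset] at hA ⊢
    obtain ⟨⟨h1, i1, j1⟩, h2, i2, j2⟩ := hA
    refine ⟨Finset.union_subset_union h1 h2, hun _ h1 _ h2 i1 i2, ?_⟩
    rw [key A₁ h1 A₂ h2]
    exact hun _ Finset.sdiff_subset _ Finset.sdiff_subset j1 j2
  · intro A hA
    simp only [Finset.mem_product, Finset.mem_filter, Finset.mem_powerset] at hA ⊢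
    obtain ⟨h1, i1, j1⟩ := hA
    refine ⟨⟨Finset.inter_subset_right, i1.mono Finset.inter_subset_left, j1.mono ?_⟩,
      Finset.inter_subset_right, i1.mono Finset.inter_subset_left, j1.mono ?_⟩ <;>
    · intro v
      simp only [Finset.mem_sdiff, Finset.mem_union, Finset.mem_inter]
      tauto
  · rintro ⟨A₁, A₂⟩ hA
    simp only [Finset.mem_product, Finset.mem_filter, Finset.mem_powerset] at hA
    obtain ⟨⟨h1, -⟩, h2, -⟩ := hA
    have h3 := Finset.disjoint_left.1 hd
    ext v <;> simp only [Finset.mem_inter, Finset.mem_union] <;>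
    · have := @h1 v
      have := @h2 v
      have := @h3 v
      tauto
  · intro A hA
    simp only [Finset.mem_filter, Finset.mem_powerset] at hA
    rw [← Finset.inter_union_distrib_left, Finset.inter_eq_left]
    exact hA.1
  · rintro ⟨A₁, A₂⟩ hA
    simp only [Finset.mem_product, Finset.mem_filter, Finset.mem_powerset] at hA
    obtain ⟨⟨h1, i1, j1⟩, h2, i2, j2⟩ := hA
    have d1 : Disjoint A₁ A₂ := Finset.disjoint_of_subset_left h1
      (Finset.disjoint_of_subset_right h2 hd)
    have d2 : Disjoint (D₁ \ A₁) (D₂ \ A₂) := Finset.disjoint_of_subset_left Finset.sdiff_subset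
      (Finset.disjoint_of_subset_right Finset.sdiff_subset hd)
    have hc : Commute (hProd h (D₁ \ A₁)) (hProd h A₂) := hProd_commute_hProd fun a ha b hb => by
      have ha' := (Finset.mem_sdiff.1 ha).1
      refine R.comm a b ?_ (hadj a ha' b (h2 hb))
      rintro rfl
      exact Finset.disjoint_left.1 hd ha' (h2 hb)
    rw [key A₁ h1 A₂ h2, R.hProd_union (hun _ h1 _ h2 i1 i2) d1,
      R.hProd_union (hun _ Finset.sdiff_subset _ Finset.sdiff_subset j1 j2) d2,
      Finset.card_union_of_disjoint d1, Finset.card_union_of_disjoint d2, smul_mul_smul_comm,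
      hc.mul_mul_mul_comm]
    congr 1
    ring

/-- In a bipartite piece with parts `A`, `B` that does not split into two mutually non-adjacent
pieces, if every vertex of `B` has at most two neighbors in `A` and `|B| < |A|`, then every
vertex of `B` has exactly two neighbors in `A`. -/
lemma card_neighbors_eq_two {A B : Finset V} (hA : IsIndep G A) (hB : IsIndep G B)
    (hconn : ∀ D₁ ⊆ A ∪ B, D₁.Nonempty → (∀ a ∈ D₁, ∀ b ∈ (A ∪ B) \ D₁, ¬ G.Adj a b) →
      D₁ = A ∪ B)
    (hdisj : Disjoint A B)
    (hdeg : ∀ b ∈ B, (A.filter (G.Adj b)).card ≤ 2) (hlt : B.card < A.card) {b : V}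
    (hb : b ∈ B) : (A.filter (G.Adj b)).card = 2 := by
  by_contra hne
  have hb1 : (A.filter (G.Adj b)).card ≤ 1 := by have := hdeg b hb; omega
  obtain ⟨Y, hY, hmax⟩ := Finset.exists_max_image
    (B.powerset.filter fun Y => b ∈ Y ∧ (A.filter fun a => ∃ y ∈ Y, G.Adj y a).card ≤ Y.card)
    Finset.card ⟨{b}, by simpa [hb] using hb1⟩
  simp only [Finset.mem_filter, Finset.mem_powerset] at hY hmax
  obtain ⟨hYB, hbY, hYc⟩ := hY
  set N := A.filter fun a => ∃ y ∈ Y, G.Adj y a with hN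
  have hNA : N ⊆ A := Finset.filter_subset _ _
  have hfull := hconn (N ∪ Y) (Finset.union_subset_union hNA hYB)
    ⟨b, Finset.mem_union_right _ hbY⟩ ?_
  · have : A ⊆ N := by
      intro a ha
      have h1 : a ∈ N ∪ Y := hfull ▸ Finset.mem_union_left _ ha
      rcases Finset.mem_union.1 h1 with h1 | h1
      · exact h1
      · exact absurd (hYB h1) (Finset.disjoint_left.1 hdisj ha)
    have := Finset.card_le_card this
    have := Finset.card_le_card hYB
    omega
  · intro u hu v hv huv
    simp only [Finset.mem_sdiff, Finset.mem_union, not_or] at hu hv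
    obtain ⟨hvD, hvN, hvY⟩ := hv
    rcases hu with hu | hu
    · have hvB : v ∈ B := hvD.resolve_left fun hvA => hA u (hNA hu) v hvA huv
      have hsub : (A.filter fun a => ∃ y ∈ insert v Y, G.Adj y a) ⊆
          N ∪ (A.filter (G.Adj v)).erase u := by
        intro a ha
        by_cases hau : a = u
        · exact Finset.mem_union_left _ (hau ▸ hu)
        · simp only [Finset.mem_filter, Finset.mem_insert, exists_eq_or_imp] at ha
          simp only [hN, Finset.mem_union, Finset.mem_filter, Finset.mem_erase]
          obtain ⟨haA, hva | hYa⟩ := ha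
          · exact Or.inr ⟨hau, haA, hva⟩
          · exact Or.inl ⟨haA, hYa⟩
      have hcard : ((A.filter (G.Adj v)).erase u).card ≤ 1 := by
        rw [Finset.card_erase_of_mem (by simp [hNA hu, huv.symm])]
        have := hdeg v hvB
        omega
      have h1 := (Finset.card_le_card hsub).trans (Finset.card_union_le _ _)
      have h2 := Finset.card_insert_of_notMem hvY
      have := hmax (insert v Y) ⟨Finset.insert_subset hvB hYB, Finset.mem_insert_of_mem hbY,
        by omega⟩
      omega
    · rcases hvD with hvA | hvB
      · exact hvN (Finset.mem_filter.2 ⟨hvA, u, hu, huv⟩)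
      · exact hB u (hYB hu) v hvB huv

lemma hProd_commute_of_card_lt (R : IsRealization G h c) (hcf : ClawFree G) {A B : Finset V}
    (hA : IsIndep G A) (hB : IsIndep G B)
    (hconn : ∀ D₁ ⊆ A ∪ B, D₁.Nonempty → (∀ a ∈ D₁, ∀ b ∈ (A ∪ B) \ D₁, ¬ G.Adj a b) →
      D₁ = A ∪ B)
    (hdisj : Disjoint A B) (hlt : B.card < A.card) :
    Commute (hProd h A) (hProd h B) := by
  refine commute_hProd fun b hb => Commute.symm ?_
  have := R.mul_hProd (x := h b) (p := G.Adj b) hA (fun v _ e => R.anti b v e)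
    (fun v hv e => R.comm b v (by rintro rfl; exact Finset.disjoint_left.1 hdisj hv hb) e)
  rw [card_neighbors_eq_two hA hB hconn hdisj (fun b _ => hcf.card_neighbors_le_two hA b) hlt hb]
    at this
  simpa [Commute, SemiconjBy] using this

lemma splitSum_comm (R : IsRealization G h c) (hcf : ClawFree G) (x y : ℂ) (D : Finset V) :
    splitSum G h x y D = splitSum G h y x D := by
  induction D using Finset.strongInduction with
  | H D ih =>
  by_cases hs : ∃ D₁ ⊆ D, D₁.Nonempty ∧ (∀ a ∈ D₁, ∀ b ∈ D \ D₁, ¬ G.Adj a b) ∧ D₁ ≠ D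
  · obtain ⟨D₁, hsub, hne, hadj, hD⟩ := hs
    rw [← Finset.union_sdiff_of_subset hsub, splitSum_union R x y Finset.disjoint_sdiff hadj,
      splitSum_union R y x Finset.disjoint_sdiff hadj, ih D₁ (hsub.ssubset_of_ne hD),
      ih (D \ D₁) (Finset.sdiff_ssubset hsub hne)]
  push Not at hs
  rcases D.eq_empty_or_nonempty with rfl | hDne
  · refine Finset.sum_congr rfl fun A hA => ?_
    have hA' : A = ∅ := by simpa using (Finset.mem_filter.1 hA).1
    simp [hA']
  by_cases hex : ∃ A ⊆ D, IsIndep G A ∧ IsIndep G (D \ A)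
  · obtain ⟨A, hAD, hA, hB⟩ := hex
    have hdd : D \ (D \ A) = A := Finset.sdiff_sdiff_eq_self hAD
    have hfilter : D.powerset.filter (fun A => IsIndep G A ∧ IsIndep G (D \ A)) = {A, D \ A} := by
      ext A'
      simp only [Finset.mem_filter, Finset.mem_powerset, Finset.mem_insert, Finset.mem_singleton]
      refine ⟨?_, ?_⟩
      · rintro ⟨hA'D, hA', hB'⟩
        by_cases hE : ((A ∩ A') ∪ ((D \ A) ∩ (D \ A'))).Nonempty
        · left
          have := hs _ (by grind) hE (by
            intro a ha b hb
            have h1 := hA a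
            have h2 := hB a
            have h3 := hA' a
            have h4 := hB' a
            grind)
          ext v
          have := Finset.ext_iff.1 this v
          grind
        · right
          rw [Finset.not_nonempty_iff_eq_empty] at hE
          ext v
          have := Finset.ext_iff.1 hE v
          grind
      · rintro (rfl | rfl)
        · exact ⟨hAD, hA, hB⟩
        · exact ⟨Finset.sdiff_subset, hB, hdd.symm ▸ hA⟩
    have hneq : A ≠ D \ A := by
      intro e
      obtain ⟨v, hv⟩ := hDne
      have := Finset.ext_iff.1 e v
      grind
    have hun : A ∪ D \ A = D := Finset.union_sdiff_of_subset hAD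
    unfold splitSum
    rw [hfilter, Finset.sum_pair hneq, Finset.sum_pair hneq, hdd]
    rcases lt_trichotomy A.card (D \ A).card with hlt | heq | hgt
    · have := hProd_commute_of_card_lt R hcf hB hA
        (by rw [Finset.union_comm, hun]; exact hs) Finset.sdiff_disjoint hlt
      rw [this.eq, mul_comm (y ^ _), mul_comm (y ^ _), add_comm]
    · rw [heq, mul_comm (y ^ _)]
    · have := hProd_commute_of_card_lt R hcf hA hB (by rw [hun]; exact hs)
        Finset.disjoint_sdiff hgt
      rw [this.eq, mul_comm (y ^ _), mul_comm (y ^ _), add_comm]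
  · push Not at hex
    have hfilter : D.powerset.filter (fun A => IsIndep G A ∧ IsIndep G (D \ A)) = ∅ :=
      Finset.filter_eq_empty_iff.2 fun A hA hAB => hex A (Finset.mem_powerset.1 hA) hAB.1 hAB.2
    simp [splitSum, hfilter]

/-- The square of the sum of `h` over a clique is a scalar. -/
lemma IsRealization.sum_clique_sq (R : IsRealization G h c) {K : Finset V}
    (hK : ∀ u ∈ K, ∀ v ∈ K, u ≠ v → G.Adj u v) :
    (∑ j ∈ K, h j) * (∑ j ∈ K, h j) = (∑ j ∈ K, c j) • 1 := by
  induction K using Finset.induction_on with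
  | empty => simp
  | insert a S ha ih =>
    have hanti : h a * (∑ j ∈ S, h j) = -((∑ j ∈ S, h j) * h a) := by
      rw [Finset.mul_sum, Finset.sum_mul, ← Finset.sum_neg_distrib]
      exact Finset.sum_congr rfl fun j hj => R.anti a j (hK a (Finset.mem_insert_self a S) j
        (Finset.mem_insert_of_mem hj) (by rintro rfl; exact ha hj))
    rw [Finset.sum_insert ha, Finset.sum_insert ha, add_mul, mul_add, mul_add, R.sq,
      ih fun u hu v hv => hK u (Finset.mem_insert_of_mem hu) v (Finset.mem_insert_of_mem hv),
      hanti, add_smul]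
    abel

variable [Fintype V]

lemma IsRealization.transferOp_mul (R : IsRealization G h c) (u w : ℂ) :
    transferOp G h u * transferOp G h w =
      ∑ p ∈ (Finset.univ : Finset (Finset V × Finset V)).filter (fun p => IsIndep G p.1 ∧
          ∀ i ∈ p.1, ∀ v ∈ p.2, i ≠ v ∧ ¬ G.Adj i v),
        ((u * w) ^ p.1.card * ∏ i ∈ p.1, c i) • splitSum G h (-u) (-w) p.2 := by
  unfold transferOp splitSum
  simp only [Finset.smul_sum]
  rw [Finset.sum_mul_sum, ← Finset.sum_product', Finset.sum_sigma']
  symm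
  refine Finset.sum_nbij' (fun q => (q.1.1 ∪ q.2, q.1.1 ∪ (q.1.2 \ q.2)))
    (fun q => ⟨(q.1 ∩ q.2, (q.1 \ q.2) ∪ (q.2 \ q.1)), q.1 \ q.2⟩) ?_ ?_ ?_ ?_ ?_
  · rintro ⟨⟨I, D⟩, A⟩ hq
    simp only [Finset.mem_sigma, Finset.mem_filter, Finset.mem_univ, true_and,
      Finset.mem_powerset, Finset.mem_product] at hq ⊢
    obtain ⟨⟨hI, hID⟩, hAD, hA, hB⟩ := hq
    exact ⟨hI.union hA fun i hi a ha => (hID i hi a (hAD ha)).2,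
      hI.union hB fun i hi a ha => (hID i hi a (Finset.sdiff_subset ha)).2⟩
  · rintro ⟨S, S'⟩ hq
    simp only [Finset.mem_sigma, Finset.mem_filter, Finset.mem_univ, true_and,
      Finset.mem_powerset, Finset.mem_product] at hq ⊢
    obtain ⟨hS, hS'⟩ := hq
    refine ⟨⟨hS.mono Finset.inter_subset_left, ?_⟩, Finset.subset_union_left,
      hS.mono Finset.sdiff_subset, hS'.mono ?_⟩
    · intro i hi v hv
      rw [Finset.mem_inter] at hi
      rcases Finset.mem_union.1 hv with hv | hv <;> rw [Finset.mem_sdiff] at hv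
      · exact ⟨by rintro rfl; exact hv.2 hi.2, hS i hi.1 v hv.1⟩
      · exact ⟨by rintro rfl; exact hv.2 hi.1, hS' i hi.2 v hv.1⟩
    · intro v hv
      simp only [Finset.mem_sdiff, Finset.mem_union] at hv
      tauto
  · rintro ⟨⟨I, D⟩, A⟩ hq
    simp only [Finset.mem_sigma, Finset.mem_filter, Finset.mem_univ, true_and,
      Finset.mem_powerset] at hq
    obtain ⟨⟨hI, hID⟩, hAD, hA, hB⟩ := hq
    have hne : ∀ v, v ∈ I → v ∉ D := fun v hv hv' => (hID v hv v hv').1 rfl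
    have hAD' : ∀ v, v ∈ A → v ∈ D := fun v hv => hAD hv
    have e1 : (I ∪ A) ∩ (I ∪ D \ A) = I := by grind
    have e2 : (I ∪ A) \ (I ∪ D \ A) = A := by grind
    have e3 : (I ∪ D \ A) \ (I ∪ A) = D \ A := by grind
    simp only [e1, e2, e3, Finset.union_sdiff_of_subset hAD]
  · rintro ⟨S, S'⟩ -
    simp only [Prod.mk.injEq]
    constructor <;> grind
  · rintro ⟨⟨I, D⟩, A⟩ hq
    simp only [Finset.mem_sigma, Finset.mem_filter, Finset.mem_univ, true_and,
      Finset.mem_powerset] at hq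
    obtain ⟨⟨hI, hID⟩, hAD, hA, hB⟩ := hq
    have hne : Disjoint I D := Finset.disjoint_left.2 fun v hv hv' => (hID v hv v hv').1 rfl
    have d1 : Disjoint I A := Finset.disjoint_of_subset_right hAD hne
    have d2 : Disjoint I (D \ A) := Finset.disjoint_of_subset_right Finset.sdiff_subset hne
    have hc : Commute (hProd h A) (hProd h I) := hProd_commute_hProd fun a ha i hi =>
      (R.comm i a (hID i hi a (hAD ha)).1 (hID i hi a (hAD ha)).2).symm
    simp only
    rw [R.hProd_union (hI.union hA fun i hi a ha => (hID i hi a (hAD ha)).2) d1,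
      R.hProd_union (hI.union hB fun i hi a ha => (hID i hi a (Finset.sdiff_subset ha)).2) d2,
      Finset.card_union_of_disjoint d1, Finset.card_union_of_disjoint d2, smul_mul_smul_comm,
      hc.mul_mul_mul_comm, R.hProd_mul_self hI, smul_one_mul, smul_smul, smul_smul]
    congr 1
    rw [pow_add, pow_add, ← neg_mul_neg u w, mul_pow]
    ring

/-- Transfer operators of a claw-free graph commute. -/
lemma IsRealization.transferOp_commute (R : IsRealization G h c) (hcf : ClawFree G) (u w : ℂ) :
    Commute (transferOp G h u) (transferOp G h w) := by
  rw [Commute, SemiconjBy, R.transferOp_mul, R.transferOp_mul]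
  simp only [splitSum_comm R hcf (-u) (-w), mul_comm u w]

lemma transferOp_eq_sum_charge (u : ℂ) :
    transferOp G h u = ∑ k ∈ Finset.range (Fintype.card V + 1), (-u) ^ k • charge G h k := by
  unfold transferOp charge
  rw [← Finset.sum_fiberwise_of_maps_to (t := Finset.range (Fintype.card V + 1))
    (g := Finset.card) fun S _ => Finset.mem_range.2 (Nat.lt_succ_of_le (Finset.card_le_univ S))]
  refine Finset.sum_congr rfl fun k _ => ?_
  rw [Finset.smul_sum, Finset.filter_filter]
  exact Finset.sum_congr rfl fun S hS => by rw [(Finset.mem_filter.1 hS).2.2]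

lemma charge_one : charge G h 1 = ∑ v, h v := by
  unfold charge
  symm
  refine Finset.sum_nbij (fun v => {v}) ?_ ?_ ?_ ?_
  · intro v _
    refine Finset.mem_filter.2 ⟨Finset.mem_univ _, ?_, Finset.card_singleton v⟩
    simp [IsIndep]
  · intro v _ w _ e
    simpa using e
  · intro S hS
    obtain ⟨v, rfl⟩ := Finset.card_eq_one.1 (Finset.mem_filter.1 hS).2.2
    exact ⟨v, by simp⟩
  · intro v _
    rw [hProd_singleton]

open Polynomial in
/-- The independent-set charges commute with the transfer operators of a claw-free graph. -/
lemma IsRealization.charge_commute_transferOp (R : IsRealization G h c) (hcf : ClawFree G)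
    (k : ℕ) (u : ℂ) : Commute (charge G h k) (transferOp G h u) := by
  by_cases hk : k ∈ Finset.range (Fintype.card V + 1)
  · set M := transferOp G h u with hM
    ext i j
    let p : ℂ[X] := ∑ l ∈ Finset.range (Fintype.card V + 1),
      C ((charge G h l * M - M * charge G h l) i j) * X ^ l
    have hp : p = 0 := by
      refine Polynomial.funext fun x => ?_
      have hx := congrFun₂ (R.transferOp_commute hcf (-x) u).eq i j
      rw [← hM, transferOp_eq_sum_charge, Finset.sum_mul, Finset.mul_sum, ← sub_eq_zero,
        ← Matrix.sub_apply, ← Finset.sum_sub_distrib, Matrix.sum_apply] at hx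
      rw [eval_zero, ← hx]
      simp only [p, eval_finsetSum]
      refine Finset.sum_congr rfl fun l _ => ?_
      simp only [neg_neg, smul_mul_assoc, mul_smul_comm, eval_mul, eval_C, eval_pow, eval_X,
        Matrix.sub_apply, Matrix.smul_apply, smul_eq_mul]
      ring
    have := congrArg (fun q => q.coeff k) hp
    simp only [p, finsetSum_coeff, coeff_C_mul, coeff_X_pow, coeff_zero, mul_ite, mul_one,
      mul_zero, Finset.sum_ite_eq, if_pos hk, Matrix.sub_apply] at this
    exact sub_eq_zero.1 this
  · have : charge G h k = 0 := by
      refine Finset.sum_eq_zero fun S hS => absurd ?_ hk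
      rw [← (Finset.mem_filter.1 hS).2.2]
      exact Finset.mem_range.2 (Nat.lt_succ_of_le (Finset.card_le_univ S))
    rw [this]
    exact Commute.zero_left _

/-- The contribution to the transfer operator of the independent sets disjoint from `K`. -/
noncomputable def transferOpAway (G : SimpleGraph V) (h : V → Matrix (Fin d) (Fin d) ℂ)
    (K : Finset V) (u : ℂ) : Matrix (Fin d) (Fin d) ℂ :=
  ∑ S ∈ Finset.univ.filter (fun S : Finset V => IsIndep G S ∧ Disjoint S K),
    (-u) ^ S.card • hProd h S

/-- For a simplicial clique `K`, the independent sets meeting `K` contribute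
`-(u / 2) * {h_K, T_{G \ K}(u)}` to the transfer operator, where `h_K` is the sum of `h` over
`K`. -/
lemma IsRealization.two_smul_transferOp_sub (R : IsRealization G h c) {K : Finset V}
    (hK : IsSimplicialClique G K) (u : ℂ) :
    (2 : ℂ) • (transferOp G h u - transferOpAway G h K u) =
      (-u) • ((∑ j ∈ K, h j) * transferOpAway G h K u
        + transferOpAway G h K u * ∑ j ∈ K, h j) := by
  have hsplit : transferOp G h u - transferOpAway G h K u =
      ∑ j ∈ K, ∑ S ∈ Finset.univ.filter (fun S : Finset V => IsIndep G S ∧ j ∈ S),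
        (-u) ^ S.card • hProd h S := by
    rw [sub_eq_iff_eq_add', transferOpAway, transferOp, ← Finset.sum_biUnion]
    · rw [← Finset.sum_union]
      · congr 1
        ext S
        simp only [Finset.mem_filter, Finset.mem_univ, true_and, Finset.mem_union,
          Finset.mem_biUnion]
        by_cases hd : Disjoint S K
        · simp only [hd, and_true]
          refine ⟨Or.inl, ?_⟩
          rintro (hS | ⟨_, _, hS, _⟩) <;> exact hS
        · have := Finset.not_disjoint_iff.1 hd
          simp only [hd, and_false, false_or]
          constructor
          · intro hS
            obtain ⟨j, hj, hjK⟩ := this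
            exact ⟨j, hjK, hS, hj⟩
          · rintro ⟨_, _, hS, _⟩
            exact hS
      · rw [Finset.disjoint_left]
        intro S hS hS'
        simp only [Finset.mem_filter, Finset.mem_univ, true_and, Finset.mem_biUnion] at hS hS'
        obtain ⟨j, hj, -, hjS⟩ := hS'
        exact Finset.disjoint_left.1 hS.2 hjS hj
    · intro i hi j hj hij
      rw [Function.onFun, Finset.disjoint_left]
      intro S hS hS'
      simp only [Finset.mem_filter, Finset.mem_univ, true_and] at hS hS'
      exact hS.1 i hS.2 j hS'.2 (hK.1 i hi j hj hij)
  rw [hsplit, Finset.sum_mul, Finset.mul_sum, ← Finset.sum_add_distrib, Finset.smul_sum,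
    Finset.smul_sum]
  refine Finset.sum_congr rfl fun j hj => ?_
  rw [transferOpAway, Finset.sum_mul, Finset.mul_sum, ← Finset.sum_add_distrib,
    Finset.smul_sum, Finset.smul_sum,
    ← Finset.sum_filter_add_sum_filter_not (Finset.univ.filter fun S : Finset V =>
      IsIndep G S ∧ Disjoint S K) (fun S => ∀ v ∈ S, ¬ G.Adj j v)]
  have hsign : ∀ S : Finset V, IsIndep G S → Disjoint S K →
      h j * hProd h S = (-1 : ℂ) ^ (S.filter (G.Adj j)).card • (hProd h S * h j) :=
    fun S hS hd => R.mul_hProd hS (fun v _ e => R.anti j v e) fun v hv e =>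
      R.comm j v (by rintro rfl; exact Finset.disjoint_left.1 hd hv hj) e
  rw [Finset.sum_eq_zero (s := Finset.filter (fun S => ¬ _) _), add_zero]
  · refine Finset.sum_nbij' (fun S => S.erase j) (fun S => insert j S) ?_ ?_ ?_ ?_ ?_
    · intro S hS
      simp only [Finset.mem_filter, Finset.mem_univ, true_and] at hS ⊢
      refine ⟨⟨hS.1.mono (Finset.erase_subset j S), Finset.disjoint_left.2 fun v hv hvK => ?_⟩,
        fun v hv => hS.1 j hS.2 v (Finset.mem_of_mem_erase hv)⟩
      exact hS.1 j hS.2 v (Finset.mem_of_mem_erase hv)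
        (hK.1 j hj v hvK (Finset.ne_of_mem_erase hv).symm)
    · intro S hS
      simp only [Finset.mem_filter, Finset.mem_univ, true_and] at hS ⊢
      refine ⟨?_, Finset.mem_insert_self j S⟩
      rw [Finset.insert_eq]
      refine IsIndep.union (by simp [IsIndep]) hS.1.1 fun a ha b hb => ?_
      rw [Finset.mem_singleton.1 ha]
      exact hS.2 b hb
    · intro S hS
      exact Finset.insert_erase (Finset.mem_filter.1 hS).2.2
    · intro S hS
      simp only [Finset.mem_filter, Finset.mem_univ, true_and] at hS
      exact Finset.erase_insert fun hjS => Finset.disjoint_left.1 hS.1.2 hjS hj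
    · intro S hS
      simp only [Finset.mem_filter, Finset.mem_univ, true_and] at hS
      have hins := Finset.insert_erase hS.2
      have hind := hS.1
      have hcomm : h j * hProd h (S.erase j) = hProd h (S.erase j) * h j :=
        commute_hProd fun v hv => R.comm j v (Finset.ne_of_mem_erase hv).symm
          (hS.1 j hS.2 v (Finset.mem_of_mem_erase hv))
      have hprod : hProd h S = h j * hProd h (S.erase j) := by
        conv_lhs => rw [← hins]
        exact R.hProd_insert (hins.symm ▸ hind) (Finset.notMem_erase j S)
      have hcard : S.card = (S.erase j).card + 1 :=
        (Finset.card_erase_add_one hS.2).symm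
      rw [hprod, hcard, mul_smul_comm, smul_mul_assoc, ← hcomm, ← two_smul ℂ, smul_smul,
        smul_smul, smul_smul]
      congr 1
      ring
  · intro S hS
    simp only [Finset.mem_filter, Finset.mem_univ, true_and] at hS
    obtain ⟨⟨hSi, hd⟩, hnb⟩ := hS
    push Not at hnb
    obtain ⟨v, hv, hjv⟩ := hnb
    have hone : S.filter (G.Adj j) = {v} := by
      ext w
      simp only [Finset.mem_filter, Finset.mem_singleton]
      refine ⟨fun hw => ?_, by rintro rfl; exact ⟨hv, hjv⟩⟩
      by_contra hne
      exact hSi w hw.1 v hv (hK.2 j hj w v (Finset.disjoint_left.1 hd hw.1)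
        (Finset.disjoint_left.1 hd hv) hne hw.2 hjv)
    rw [mul_smul_comm, smul_mul_assoc, hsign S hSi hd, hone]
    simp

/-- A simplicial mode, dressed by `1 - u * h_K`, is intertwined by the transfer operator. -/
lemma IsRealization.simplicialMode_transferOp (R : IsRealization G h c) {K : Finset V}
    (hK : IsSimplicialClique G K) {χ : Matrix (Fin d) (Fin d) ℂ}
    (hanti : ∀ j ∈ K, χ * h j = -(h j * χ)) (hcomm : ∀ v, v ∉ K → χ * h v = h v * χ) (u : ℂ) :
    (χ - u • ((∑ j ∈ K, h j) * χ)) * transferOp G h u =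
      transferOp G h u * (χ - u • (χ * ∑ j ∈ K, h j)) := by
  set k := ∑ j ∈ K, h j with hk
  set A := transferOpAway G h K u with hA
  obtain ⟨B, hB⟩ : ∃ B, transferOp G h u = A + B := ⟨_, (add_sub_cancel _ _).symm⟩
  have h2 : (2 : ℂ) • B = (-u) • (k * A + A * k) := by
    rw [← R.two_smul_transferOp_sub hK u, hB, add_sub_cancel_left]
  have hχk : χ * k = -(k * χ) := by
    rw [hk, Finset.mul_sum, Finset.sum_mul, ← Finset.sum_neg_distrib]
    exact Finset.sum_congr rfl hanti
  have hχA : χ * A = A * χ := by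
    rw [hA, transferOpAway, Finset.mul_sum, Finset.sum_mul]
    refine Finset.sum_congr rfl fun S hS => ?_
    rw [mul_smul_comm, smul_mul_assoc]
    congr 1
    exact commute_hProd fun v hv =>
      hcomm v (Finset.disjoint_left.1 (Finset.mem_filter.1 hS).2.2 hv)
  have hB' : B = (-u / 2) • (k * A + A * k) := by
    rw [div_eq_inv_mul, mul_smul, ← h2, smul_smul]
    norm_num
  have hχB : χ * B = -(B * χ) := by
    have e1 : χ * (k * A) = -(k * A * χ) := by
      rw [← mul_assoc, hχk, neg_mul, mul_assoc, hχA, mul_assoc]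
    have e2 : χ * (A * k) = -(A * k * χ) := by
      rw [← mul_assoc, hχA, mul_assoc, hχk, mul_neg, mul_assoc]
    rw [hB', mul_smul_comm, smul_mul_assoc, mul_add, e1, e2, add_mul, ← smul_neg, neg_add]
  have hkB : k * B = B * k := by
    have hkk : k * k = (∑ j ∈ K, c j) • 1 := R.sum_clique_sq hK.1
    rw [hB', mul_smul_comm, smul_mul_assoc, mul_add, add_mul, ← mul_assoc k k, mul_assoc A k k,
      hkk, smul_one_mul, mul_smul_one, mul_assoc k A k, add_comm]
  rw [hB, hχk]
  have hl : (χ - u • (k * χ)) * (A + B) = ((A - B) - u • (k * (A - B))) * χ := by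
    simp only [sub_mul, mul_add, mul_sub, smul_mul_assoc, mul_assoc, hχA, hχB, mul_neg]
    module
  have hr : (A + B) * (χ - u • -(k * χ)) = ((A + B) + u • ((A + B) * k)) * χ := by
    simp only [add_mul, mul_sub, smul_mul_assoc, mul_smul_comm, mul_assoc, mul_neg]
    module
  rw [hl, hr]
  congr 1
  rw [mul_sub, add_mul, hkB]
  have : A - B - u • (k * A - B * k) - (A + B + u • (A * k + B * k)) =
      (-u) • (k * A + A * k) - (2 : ℂ) • B := by module
  rw [← sub_eq_zero, this, h2, sub_self]

end Aux

/-- Lemma 17: with `H = Σ_v h(v)`, a nonzero root parameter `u₀`, and a matrix `P` commuting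
with every independent-set charge and annihilating `T_G(u₀)·T_G(−u₀)`, the incognito mode
`ψ = P·T_G(−u₀)·χ·T_G(u₀)` satisfies the eigenmode relation `H·ψ − ψ·H = (2/u₀)·ψ`. -/
theorem incognito_mode_eigenrelation {V : Type u} [Fintype V] [DecidableEq V]
    (G : SimpleGraph V) (hcf : ClawFree G) (d : ℕ) (hd : 0 < d)
    (h : V → Matrix (Fin d) (Fin d) ℂ) (b : V → ℝ) (hb : ∀ v, b v ≠ 0)
    (hsq : ∀ v, h v * h v = ((b v : ℂ)) ^ 2 • (1 : Matrix (Fin d) (Fin d) ℂ))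
    (hanti : ∀ u v, G.Adj u v → h u * h v = -(h v * h u))
    (hcomm : ∀ u v, u ≠ v → ¬ G.Adj u v → h u * h v = h v * h u)
    (Ks : Finset V) (hKs : IsSimplicialClique G Ks)
    (χ : Matrix (Fin d) (Fin d) ℂ) (hχsq : χ * χ = 1)
    (hχanti : ∀ j ∈ Ks, χ * h j = -(h j * χ))
    (hχcomm : ∀ v : V, v ∉ Ks → χ * h v = h v * χ)
    (u₀ : ℂ) (hu₀ : u₀ ≠ 0) (P : Matrix (Fin d) (Fin d) ℂ)
    (hPQ : ∀ k : ℕ, P * charge G h k = charge G h k * P)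
    (hPT : P * (transferOp G h u₀ * transferOp G h (-u₀)) = 0)
    (ψ : Matrix (Fin d) (Fin d) ℂ)
    (hψ : ψ = P * transferOp G h (-u₀) * χ * transferOp G h u₀) :
    (∑ v : V, h v) * ψ - ψ * (∑ v : V, h v) = (2 / u₀) • ψ := by
  have R : IsRealization G h fun v => (b v : ℂ) ^ 2 := ⟨hsq, hanti, hcomm⟩
  set T := transferOp G h u₀ with hT
  set T' := transferOp G h (-u₀) with hT'
  set k := ∑ j ∈ Ks, h j with hk
  rw [← charge_one (G := G)]
  set H := charge G h 1 with hH
  have hPH : P * H = H * P := hPQ 1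
  have hHT : H * T = T * H := R.charge_commute_transferOp hcf 1 u₀
  have hHT' : H * T' = T' * H := R.charge_commute_transferOp hcf 1 (-u₀)
  have hTT' : T' * T = T * T' := R.transferOp_commute hcf (-u₀) u₀
  have hHχ : H * χ - χ * H = (2 : ℂ) • (k * χ) := by
    rw [hH, charge_one, ← Finset.sum_add_sum_compl Ks, ← hk]
    have e1 : χ * k = -(k * χ) := by
      rw [hk, Finset.mul_sum, Finset.sum_mul, ← Finset.sum_neg_distrib]
      exact Finset.sum_congr rfl hχanti
    have e2 : χ * (∑ v ∈ Ksᶜ, h v) = (∑ v ∈ Ksᶜ, h v) * χ := by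
      rw [Finset.mul_sum, Finset.sum_mul]
      exact Finset.sum_congr rfl fun v hv => hχcomm v (Finset.mem_compl.1 hv)
    rw [add_mul, mul_add, e1, e2]
    module
  have hzero : P * T' * (χ - u₀ • (k * χ)) * T = 0 := by
    rw [mul_assoc _ _ T, R.simplicialMode_transferOp hKs hχanti hχcomm, ← hT, ← mul_assoc,
      mul_assoc P, hTT', hPT, zero_mul]
  have hψk : ψ = u₀ • (P * T' * (k * χ) * T) := by
    rw [hψ]
    simpa only [mul_sub, sub_mul, mul_smul_comm, smul_mul_assoc, sub_eq_zero] using hzero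
  have hcommutator : H * ψ - ψ * H = P * T' * (H * χ - χ * H) * T := by
    have e1 : H * (P * T' * χ * T) = P * T' * (H * χ) * T := by
      simp only [← mul_assoc]
      rw [← hPH, mul_assoc P H, hHT']
      simp only [← mul_assoc]
    have e2 : P * T' * χ * T * H = P * T' * (χ * H) * T := by
      rw [mul_assoc _ T H, ← hHT]
      simp only [← mul_assoc]
    rw [hψ, e1, e2, mul_sub, sub_mul]
  rw [hcommutator, hHχ, hψk, smul_smul, div_mul_cancel₀ _ hu₀, mul_smul_comm, smul_mul_assoc]
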